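/- Let K₁ ⊂ K₂ be nonempty ℍ-hulls such that the closure of the quotient hull K₂/K₁ := g_{K₁}(K₂ \ K₁) intersects [c_{K₁}, d_{K₁}]. Then |c_{K₁} - c_{K₂}| ≤ 4·diam(K₂/K₁) and |d_{K₁} - d_{K₂}| ≤ 4·diam(K₂/K₁). -/

import Mathlib

open Complex Filter Set Metric Bornology Topology

noncomputable section

/-- The open upper half-plane `ℍ`. -/
def UHP : Set ℂ := {z : ℂ | 0 < z.im}

/-- `K^doub`: the closure of `K` together with its reflection across `ℝ`. -/
def Kdoub (K : Set ℂ) : Set ℂ := closure K ∪ (starRingEnd ℂ) '' closure K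

/-- `a_K = min (cl K ∩ ℝ)`. -/
def aK (K : Set ℂ) : ℝ := sInf {x : ℝ | (x : ℂ) ∈ closure K}

/-- `b_K = max (cl K ∩ ℝ)`. -/
def bK (K : Set ℂ) : ℝ := sSup {x : ℝ | (x : ℂ) ∈ closure K}

/-- The segment `[a_K, b_K]` regarded as a subset of `ℂ`. -/
def seg (K : Set ℂ) : Set ℂ := (fun t : ℝ => (t : ℂ)) '' Set.Icc (aK K) (bK K)

/-- `K` is an `ℍ`-hull with mapping-out function `g` (normalized hydrodynamically at `∞`),
whose Schwarz reflection maps the complement of `K^doub ∪ [a_K, b_K]` onto `ℂ \ S_K`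
for the compact set `S = S_K ⊆ ℝ`. -/
structure IsHullMap (K : Set ℂ) (g : ℂ → ℂ) (S : Set ℝ) : Prop where
  subset_UHP : K ⊆ UHP
  bounded : IsBounded K
  relClosed : ∀ z ∈ closure K, 0 < z.im → z ∈ K
  holo : DifferentiableOn ℂ g (UHP \ K)
  bij : Set.BijOn g (UHP \ K) UHP
  hydro : Tendsto (fun z => g z - z) (Bornology.cobounded ℂ) (nhds 0)
  compactS : IsCompact S
  ext_holo : K.Nonempty → DifferentiableOn ℂ g {z : ℂ | z ∉ Kdoub K}
  real_vals : K.Nonempty → ∀ x : ℝ, (x : ℂ) ∉ Kdoub K → (g (x : ℂ)).im = 0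
  conj_symm : K.Nonempty → ∀ z : ℂ, z ∉ Kdoub K → g ((starRingEnd ℂ) z) = (starRingEnd ℂ) (g z)
  extBij : K.Nonempty →
    Set.BijOn g {z : ℂ | z ∉ Kdoub K ∧ z ∉ seg K} {z : ℂ | ∀ s ∈ S, z ≠ (s : ℂ)}

/-- `g` has half-plane capacity `c` : `g z = z + c / z + O(1/z²)` near `∞`. -/
def HasHcap (g : ℂ → ℂ) (c : ℝ) : Prop :=
  Tendsto (fun z : ℂ => z * (g z - z)) (Bornology.cobounded ℂ) (nhds (c : ℂ))

theorem nhds_le_map_of_leftInverse {g f : ℂ → ℂ} {D : Set ℂ} (hD : IsOpen D)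
    (hg : DifferentiableOn ℂ g D) (hf : ∀ z ∈ D, f (g z) = z) {z : ℂ} (hz : z ∈ D) :
    𝓝 (g z) ≤ map g (𝓝 z) := by
  have hDz : D ∈ 𝓝 z := hD.mem_nhds hz
  refine (hg.analyticAt hDz).eventually_constant_or_nhds_le_map_nhds.resolve_left fun h => ?_
  have h1 : ∀ᶠ w in 𝓝[≠] z, w = z := by
    filter_upwards [nhdsWithin_le_nhds h, nhdsWithin_le_nhds hDz] with w hw hwD
    rw [← hf w hwD, hw, hf z hz]
  obtain ⟨w, hw, hw'⟩ := (h1.and self_mem_nhdsWithin).exists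
  exact hw' hw

/-- A left inverse of an injective holomorphic function is holomorphic on its image. -/
theorem differentiableAt_of_leftInverse {g f : ℂ → ℂ} {D : Set ℂ} (hD : IsOpen D)
    (hg : DifferentiableOn ℂ g D) (hf : ∀ z ∈ D, f (g z) = z) {z : ℂ} (hz : z ∈ D) :
    DifferentiableAt ℂ f (g z) := by
  have hcont : ∀ w ∈ D, ContinuousAt f (g w) := by
    intro w hw
    rw [ContinuousAt, hf w hw]
    refine (tendsto_map'_iff.2 ?_).mono_left (nhds_le_map_of_leftInverse hD hg hf hw)
    refine tendsto_id.congr' ?_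
    filter_upwards [hD.mem_nhds hw] with y hy using (hf y hy).symm
  have hreg : ∀ w ∈ D, deriv g w ≠ 0 → DifferentiableAt ℂ f (g w) := by
    intro w hw hne
    refine (HasDerivAt.of_local_left_inverse (f := g) (f' := deriv g w) (hcont w hw) ?_ hne
      ?_).differentiableAt
    · rw [hf w hw]
      exact (hg.differentiableAt (hD.mem_nhds hw)).hasDerivAt
    · refine nhds_le_map_of_leftInverse hD hg hf hw ?_
      change ∀ᶠ y in 𝓝 w, g (f (g y)) = g y
      filter_upwards [hD.mem_nhds hw] with y hy
      rw [hf y hy]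
  have hDz : D ∈ 𝓝 z := hD.mem_nhds hz
  refine (analyticAt_of_differentiable_on_punctured_nhds_of_continuousAt ?_
    (hcont z hz)).differentiableAt
  have hder : ∀ᶠ w in 𝓝[≠] z, deriv g w ≠ 0 := by
    refine (hg.analyticAt hDz).deriv.eventually_eq_zero_or_eventually_ne_zero.resolve_left
      fun h => ?_
    obtain ⟨r, hr, hb⟩ := Metric.mem_nhds_iff.1 (inter_mem h hDz)
    have hconst : ∀ w ∈ ball z r, g w = g z := fun w hw =>
      isOpen_ball.is_const_of_deriv_eq_zero (convex_ball z r).isPreconnected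
        (hg.mono fun y hy => (hb hy).2) (fun y hy => (hb hy).1) hw (mem_ball_self hr)
    have h1 : ∀ᶠ w in 𝓝[≠] z, w = z := by
      filter_upwards [nhdsWithin_le_nhds (ball_mem_nhds z hr)] with w hw
      rw [← hf w (hb hw).2, hconst w hw, hf z hz]
    obtain ⟨w, hw, hw'⟩ := (h1.and self_mem_nhdsWithin).exists
    exact hw' hw
  rw [eventually_nhdsWithin_iff]
  refine nhds_le_map_of_leftInverse hD hg hf hz ?_
  change ∀ᶠ y in 𝓝 z, g y ∈ ({g z} : Set ℂ)ᶜ → DifferentiableAt ℂ f (g y)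
  filter_upwards [hDz, eventually_nhdsWithin_iff.1 hder] with y hy hy' hne
  exact hreg y hy (hy' fun h => hne (by rw [mem_singleton_iff.1 h]; rfl))

theorem tendsto_cobounded_of_sub_tendsto {g : ℂ → ℂ} {c : ℂ}
    (h : Tendsto (fun z => g z - z) (cobounded ℂ) (𝓝 c)) :
    Tendsto g (cobounded ℂ) (cobounded ℂ) := by
  rw [← tendsto_norm_atTop_iff_cobounded]
  have h1 : Tendsto (fun z : ℂ => ‖z‖ - ‖g z - z‖) (cobounded ℂ) atTop := by
    have := (tendsto_norm_cobounded_atTop (E := ℂ)).atTop_add h.norm.neg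
    simpa [sub_eq_add_neg] using this
  refine tendsto_atTop_mono (fun z => ?_) h1
  have := norm_sub_le (g z) (g z - z)
  simp only [sub_sub_cancel] at this
  linarith

/-- A function holomorphic and asymptotic to the identity at `∞` is open at `∞`. -/
theorem cobounded_le_map_of_sub_tendsto_zero {g : ℂ → ℂ}
    (hd : ∀ᶠ z in cobounded ℂ, DifferentiableAt ℂ g z)
    (h : Tendsto (fun z => g z - z) (cobounded ℂ) (𝓝 0)) :
    cobounded ℂ ≤ map g (cobounded ℂ) := by
  classical
  have hg := tendsto_cobounded_of_sub_tendsto h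
  have hne : ∀ᶠ z in cobounded ℂ, g z ≠ 0 := hg.eventually (eventually_ne_cobounded 0)
  let G : ℂ → ℂ := Function.update (fun ζ => (g ζ⁻¹)⁻¹) 0 0
  have hG : ∀ ζ ≠ 0, G ζ = (g ζ⁻¹)⁻¹ := fun ζ hζ => Function.update_of_ne hζ _ _
  have hG0 : G 0 = 0 := Function.update_self _ _ _
  have hcont : ContinuousAt G 0 := by
    rw [continuousAt_update_same]
    exact tendsto_inv₀_cobounded.comp (hg.comp tendsto_inv₀_nhdsNE_zero)
  have han : AnalyticAt ℂ G 0 := by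
    refine analyticAt_of_differentiable_on_punctured_nhds_of_continuousAt ?_ hcont
    filter_upwards [tendsto_inv₀_nhdsNE_zero.eventually (hd.and hne), self_mem_nhdsWithin]
      with ζ hζ hζ0
    have : DifferentiableAt ℂ (fun ζ : ℂ => (g ζ⁻¹)⁻¹) ζ :=
      (hζ.1.comp ζ (differentiableAt_inv hζ0)).inv hζ.2
    refine this.congr_of_eventuallyEq ?_
    filter_upwards [isOpen_ne.mem_nhds hζ0] with y hy using hG y hy
  have hopen : 𝓝 (0 : ℂ) ≤ map G (𝓝 0) := by
    have := han.eventually_constant_or_nhds_le_map_nhds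
    rw [hG0] at this
    refine this.resolve_left fun hc => ?_
    obtain ⟨ζ, ⟨h1, h2⟩, h3⟩ := ((hc.filter_mono nhdsWithin_le_nhds).and
      (tendsto_inv₀_nhdsNE_zero.eventually hne) |>.and self_mem_nhdsWithin).exists
    rw [hG ζ h3, inv_eq_zero] at h1
    exact h2 h1
  intro s hs
  have h1 : ∀ᶠ ζ in 𝓝 (0 : ℂ), ζ ≠ 0 → ζ⁻¹ ∈ s := by
    refine hopen ?_
    have := tendsto_inv₀_nhdsNE_zero.eventually (mem_map.1 hs)
    rw [eventually_nhdsWithin_iff] at this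
    change ∀ᶠ ζ in 𝓝 (0 : ℂ), G ζ ≠ 0 → (G ζ)⁻¹ ∈ s
    filter_upwards [this] with ζ hζ hGζ
    have hζ0 : ζ ≠ 0 := by rintro rfl; exact hGζ hG0
    rw [hG ζ hζ0, inv_inv]
    exact hζ hζ0
  have h2 := tendsto_inv₀_cobounded'.eventually (eventually_nhdsWithin_iff.2 h1)
  filter_upwards [h2] with w hw
  simpa using hw

/-- Comparison of imaginary parts on the complement of a half-disc in the upper half-plane. -/
theorem im_halfDisc_map_le {F : ℂ → ℂ} {x₀ r : ℝ}
    (hd : ∀ w : ℂ, 0 < w.im → r < ‖w - x₀‖ → DifferentiableAt ℂ F w)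
    (hpos : ∀ w : ℂ, 0 < w.im → r < ‖w - x₀‖ → 0 < (F w).im)
    (h : Tendsto (fun z => F z - z) (cobounded ℂ) (𝓝 0)) {w : ℂ} (hw : 0 < w.im)
    (hwr : r < ‖w - x₀‖) : (w + r ^ 2 / (w - x₀)).im ≤ (F w).im := by
  have him : ∀ z : ℂ, (z + r ^ 2 / (z - x₀)).im = z.im - r ^ 2 * z.im / ‖z - x₀‖ ^ 2 := by
    intro z
    rw [← Complex.normSq_eq_norm_sq]
    simp [Complex.div_im, ← Complex.ofReal_pow]
    ring
  have hgt : ∀ z : ℂ, 0 < z.im → 0 < (z + r ^ 2 / (z - x₀)).im → r < ‖z - x₀‖ := by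
    intro z hz h1
    rw [him] at h1
    by_contra! h2
    have h3 : 0 < ‖z - x₀‖ := by
      rw [norm_pos_iff]
      intro h0
      have := congrArg Complex.im h0
      simp at this
      exact hz.ne' this
    have : z.im ≤ r ^ 2 * z.im / ‖z - x₀‖ ^ 2 := by
      rw [le_div_iff₀ (by positivity)]
      have : ‖z - x₀‖ ^ 2 ≤ r ^ 2 := by gcongr
      nlinarith
    linarith
  have hle : ∀ z : ℂ, 0 < z.im → (z + r ^ 2 / (z - x₀)).im ≤ z.im := by
    intro z hz
    rw [him]
    have : 0 ≤ r ^ 2 * z.im / ‖z - x₀‖ ^ 2 := by positivity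
    linarith
  have hdiffG : ∀ z : ℂ, 0 < z.im → DifferentiableAt ℂ (fun z : ℂ => z + r ^ 2 / (z - x₀)) z := by
    intro z hz
    have : z - x₀ ≠ 0 := by
      intro h0
      have := congrArg Complex.im h0
      simp at this
      exact hz.ne' this
    fun_prop (disch := assumption)
  let φ : ℂ → ℂ := fun z => z + r ^ 2 / (z - x₀) - F z
  have hφ0 : Tendsto φ (cobounded ℂ) (𝓝 0) := by
    have h1 : Tendsto (fun z : ℂ => (r : ℂ) ^ 2 / (z - x₀)) (cobounded ℂ) (𝓝 0) := by
      have h2 : Tendsto (fun z : ℂ => z - x₀) (cobounded ℂ) (cobounded ℂ) :=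
        tendsto_cobounded_of_sub_tendsto (c := -x₀) (by simp)
      simpa [div_eq_mul_inv] using (tendsto_inv₀_cobounded.comp h2).const_mul ((r : ℂ) ^ 2)
    have := h1.sub h
    simp only [sub_zero] at this
    refine this.congr fun z => ?_
    simp only [φ]; ring
  by_contra! hlt
  have hφim : ∀ z, (φ z).im = (z + r ^ 2 / (z - x₀)).im - (F z).im := fun z => Complex.sub_im _ _
  obtain ⟨ε, hε, hεw⟩ : ∃ ε : ℝ, 0 < ε ∧ ε < (φ w).im := exists_between (by rw [hφim]; linarith)
  obtain ⟨R, hwR, hR⟩ : ∃ R, ‖w‖ < R ∧ ∀ z : ℂ, R ≤ ‖z‖ → (φ z).im ≤ ε := by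
    have h1 : ∀ᶠ z in cobounded ℂ, (φ z).im ≤ ε := by
      filter_upwards [hφ0.norm.eventually (gt_mem_nhds (by simpa using hε))] with z hz
      exact ((le_abs_self _).trans (Complex.abs_im_le_norm _)).trans hz.le
    rw [← comap_norm_atTop, eventually_comap, eventually_atTop] at h1
    obtain ⟨R, hR⟩ := h1
    exact ⟨max R (‖w‖ + 1), by simp, fun z hz => hR ‖z‖ (le_of_max_le_left hz) z rfl⟩
  let U : Set ℂ := {z | ε < z.im ∧ ε < (z + r ^ 2 / (z - x₀)).im ∧ ‖z‖ < R}
  have hGcont : ∀ z : ℂ, 0 < z.im →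
      ContinuousAt (fun z : ℂ => (z + r ^ 2 / (z - x₀)).im) z := fun z hz =>
    Complex.continuous_im.continuousAt.comp (hdiffG z hz).continuousAt
  have hcl : ∀ z ∈ closure U, 0 < z.im ∧ ε ≤ (z + r ^ 2 / (z - x₀)).im := by
    intro z hz
    have h1 : ε ≤ z.im :=
      closure_minimal (fun y hy => le_of_lt hy.1) (isClosed_le continuous_const
        Complex.continuous_im) hz
    refine ⟨hε.trans_le h1, ?_⟩
    exact ContinuousWithinAt.closure_le hz continuousWithinAt_const
      (hGcont z (hε.trans_le h1)).continuousWithinAt fun y hy => hy.2.1.le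
  have hdiff : DifferentiableOn ℂ (fun z => Complex.exp (-Complex.I * φ z)) (closure U) := by
    intro z hz
    obtain ⟨h1, h2⟩ := hcl z hz
    exact (((hdiffG z h1).sub (hd z h1 (hgt z h1 (hε.trans_le h2)))).const_mul
      (-Complex.I)).cexp.differentiableWithinAt
  have hnorm : ∀ z, ‖Complex.exp (-Complex.I * φ z)‖ = Real.exp (φ z).im := by
    intro z
    simp [Complex.norm_exp]
  have hmem : w ∈ U := by
    have h1 := hpos w hw hwr
    have h2 := hle w hw
    rw [hφim] at hεw
    exact ⟨by linarith, by linarith, hwR⟩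
  have hUb : IsBounded U := isBounded_ball.subset fun z hz => mem_ball_zero_iff.2 hz.2.2
  have hmax := Complex.norm_le_of_forall_mem_frontier_norm_le (C := Real.exp ε) hUb
    hdiff.diffContOnCl ?_ (subset_closure hmem)
  · rw [hnorm, Real.exp_le_exp] at hmax
    linarith
  · intro z hz
    rw [hnorm, Real.exp_le_exp]
    obtain ⟨h1, h2⟩ := hcl z hz.1
    have h3 := hpos z h1 (hgt z h1 (hε.trans_le h2))
    by_contra! h4
    have h5 : ‖z‖ < R := by
      by_contra! h5
      exact h4.not_ge (hR z h5)
    have h6 : ε < (z + r ^ 2 / (z - x₀)).im := by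
      rw [hφim] at h4
      linarith
    refine hz.2 (mem_interior_iff_mem_nhds.2 ?_)
    filter_upwards [Complex.continuous_im.continuousAt.eventually
      (lt_mem_nhds (h6.trans_le (hle z h1))), (hGcont z h1).eventually (lt_mem_nhds h6),
      continuous_norm.continuousAt.eventually (gt_mem_nhds h5)] with y a b c
    exact ⟨a, b, c⟩

theorem tendsto_ofReal_atBot_cobounded :
    Tendsto (fun t : ℝ => (t : ℂ)) atBot (cobounded ℂ) := by
  rw [← tendsto_norm_atTop_iff_cobounded]
  simpa using tendsto_abs_atBot_atTop

/-- Boundary version of `im_halfDisc_map_le` to the left of the half-disc. -/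
theorem halfDisc_map_le_of_lt {F : ℂ → ℂ} {x₀ r c : ℝ}
    (hd : ∀ w : ℂ, 0 < w.im → r < ‖w - x₀‖ → DifferentiableAt ℂ F w)
    (hpos : ∀ w : ℂ, 0 < w.im → r < ‖w - x₀‖ → 0 < (F w).im) (hr : 0 ≤ r)
    (h : Tendsto (fun z => F z - z) (cobounded ℂ) (𝓝 0)) (hc : c ≤ x₀ - r)
    (hdr : ∀ t : ℝ, t < c → DifferentiableAt ℂ F t) (hreal : ∀ t : ℝ, t < c → (F t).im = 0)
    {t : ℝ} (ht : t < c) : t + r ^ 2 / (t - x₀) ≤ (F t).re := by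
  let H : ℂ → ℂ := fun z => F z - (z + r ^ 2 / (z - x₀))
  have hHd : ∀ s : ℝ, s < c → DifferentiableAt ℂ H s := by
    intro s hs
    have : (s : ℂ) - x₀ ≠ 0 := by
      rw [← Complex.ofReal_sub, Complex.ofReal_ne_zero]
      linarith
    have h2 : DifferentiableAt ℂ (fun z : ℂ => z + r ^ 2 / (z - x₀)) s := by
      fun_prop (disch := assumption)
    exact (hdr s hs).sub h2
  have hHim : ∀ s : ℝ, s < c → (H s).im = 0 := by
    intro s hs
    have : (s : ℂ) + r ^ 2 / (s - x₀) = ((s + r ^ 2 / (s - x₀) : ℝ) : ℂ) := by push_cast; rfl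
    simp only [H, Complex.sub_im, hreal s hs, this, Complex.ofReal_im, sub_zero]
  have hderiv : ∀ s : ℝ, s < c → 0 ≤ (deriv H s).re := by
    intro s hs
    have h1 : HasDerivAt (fun y : ℝ => (s : ℂ) + y * Complex.I) Complex.I 0 := by
      simpa using ((Complex.ofRealCLM.hasDerivAt (x := (0 : ℝ))).mul_const Complex.I).const_add
        (s : ℂ)
    have h2 : HasDerivAt (fun y : ℝ => H (s + y * Complex.I)) (deriv H s * Complex.I) 0 := by
      refine HasDerivAt.comp (h₂ := H) (0 : ℝ) ?_ h1
      simpa using (hHd s hs).hasDerivAt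
    have h3 : HasDerivAt (fun y : ℝ => (H (s + y * Complex.I)).im) (deriv H s).re 0 := by
      have := Complex.imCLM.hasFDerivAt.comp_hasDerivAt (0 : ℝ) h2
      simpa [Function.comp_def] using! this
    have h4 := h3.hasDerivWithinAt (s := Ioi 0)
    rw [hasDerivWithinAt_iff_tendsto_slope' (by simp)] at h4
    refine ge_of_tendsto h4 ?_
    filter_upwards [self_mem_nhdsWithin] with y hy
    have hy : 0 < y := hy
    rw [slope_def_field]
    simp only [Complex.ofReal_zero, zero_mul, add_zero, hHim s hs, sub_zero]
    refine div_nonneg ?_ hy.le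
    have := im_halfDisc_map_le hd hpos h (w := s + y * Complex.I) (by simpa using hy) ?_
    · rw [Complex.sub_im]
      linarith
    · have e : (s + y * Complex.I : ℂ) - x₀ = (s - x₀ : ℝ) + y * Complex.I := by push_cast; ring
      rw [e]
      refine lt_of_lt_of_le ?_ (Complex.abs_re_le_norm _)
      simp only [Complex.add_re, Complex.ofReal_re, Complex.mul_re, Complex.I_re, mul_zero,
        Complex.ofReal_im, Complex.I_im, zero_mul, sub_zero, add_zero]
      rw [abs_of_neg (by linarith)]
      linarith
  have hmono : MonotoneOn (fun s : ℝ => (H s).re) (Iio c) := by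
    have hd' : ∀ s < c, HasDerivAt (fun s : ℝ => (H s).re) (deriv H s).re s := fun s hs =>
      (hHd s hs).hasDerivAt.real_of_complex
    refine monotoneOn_of_deriv_nonneg (convex_Iio c)
      (fun s hs => (hd' s hs).continuousAt.continuousWithinAt) ?_ ?_
    · rw [interior_Iio]
      exact fun s hs => (hd' s hs).differentiableAt.differentiableWithinAt
    · rw [interior_Iio]
      intro s hs
      rw [(hd' s hs).deriv]
      exact hderiv s hs
  have hlim : Tendsto (fun s : ℝ => (H s).re) atBot (𝓝 0) := by
    have h1 : Tendsto (fun z : ℂ => (r : ℂ) ^ 2 / (z - x₀)) (cobounded ℂ) (𝓝 0) := by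
      have h2 : Tendsto (fun z : ℂ => z - x₀) (cobounded ℂ) (cobounded ℂ) :=
        tendsto_cobounded_of_sub_tendsto (c := -x₀) (by simp)
      simpa [div_eq_mul_inv] using (tendsto_inv₀_cobounded.comp h2).const_mul ((r : ℂ) ^ 2)
    have h3 : Tendsto H (cobounded ℂ) (𝓝 0) := by
      have := h.sub h1
      simp only [sub_zero] at this
      refine this.congr fun z => ?_
      simp only [H]; ring
    simpa [Function.comp_def] using (Complex.continuous_re.tendsto 0).comp
      (h3.comp tendsto_ofReal_atBot_cobounded)
  have h0 : 0 ≤ (H t).re := by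
    refine le_of_tendsto hlim ?_
    filter_upwards [eventually_le_atBot t] with s hs
    exact hmono (hs.trans_lt ht) ht hs
  have e : (t : ℂ) + r ^ 2 / (t - x₀) = ((t + r ^ 2 / (t - x₀) : ℝ) : ℂ) := by push_cast; rfl
  simp only [H, Complex.sub_re, e, Complex.ofReal_re] at h0
  linarith

/-- A continuous function on a left half-line asymptotic to the identity and avoiding `S`
stays to the left of `S`. -/
theorem le_of_forall_notMem {F : ℂ → ℂ} {c : ℝ} {S : Set ℝ}
    (hF : ∀ t : ℝ, t < c → ContinuousAt F t)
    (h : Tendsto (fun z => F z - z) (cobounded ℂ) (𝓝 0))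
    (hS : ∀ t : ℝ, t < c → (F t).re ∉ S) {t s : ℝ} (ht : t < c) (hs : s ∈ S) :
    (F t).re ≤ s := by
  by_contra! hlt
  have hlim : Tendsto (fun u : ℝ => (F u).re) atBot atBot := by
    have h1 : Tendsto (fun u : ℝ => (F u - u).re) atBot (𝓝 0) := by
      simpa [Function.comp_def] using (Complex.continuous_re.tendsto 0).comp
        (h.comp tendsto_ofReal_atBot_cobounded)
    refine (tendsto_id.atBot_add h1).congr fun u => ?_
    simp
  obtain ⟨u, hu, hut⟩ := ((hlim.eventually (eventually_le_atBot s)).and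
    (eventually_le_atBot t)).exists
  obtain ⟨v, hv, hvs⟩ := intermediate_value_Icc (f := fun u : ℝ => (F u).re) hut
    (fun v hv => (Complex.continuous_re.continuousAt.comp ((hF v (hv.2.trans_lt ht)).comp
      Complex.continuous_ofReal.continuousAt)).continuousWithinAt) ⟨hu, hlt.le⟩
  exact hS v (hv.2.trans_lt ht) (by rw [← hvs] at hs; exact hs)

/-- Being off `S`, where `S ⊆ ℝ` is viewed inside `ℂ`. -/
def offReal (S : Set ℝ) : Set ℂ := {z : ℂ | ∀ s ∈ S, z ≠ (s : ℂ)}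

/-- The domain of the extended mapping-out function. -/
def extDomain (K : Set ℂ) : Set ℂ := {z : ℂ | z ∉ Kdoub K ∧ z ∉ seg K}

theorem isCompact_Kdoub {K : Set ℂ} (hK : IsBounded K) : IsCompact (Kdoub K) :=
  hK.isCompact_closure.union (hK.isCompact_closure.image Complex.continuous_conj)

theorem isCompact_seg (K : Set ℂ) : IsCompact (seg K) :=
  isCompact_Icc.image Complex.continuous_ofReal

theorem conj_mem_Kdoub {K : Set ℂ} {z : ℂ} : (starRingEnd ℂ) z ∈ Kdoub K ↔ z ∈ Kdoub K := by
  have h : ∀ z, z ∈ Kdoub K → (starRingEnd ℂ) z ∈ Kdoub K := by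
    rintro z (hz | ⟨y, hy, rfl⟩)
    · exact Or.inr ⟨z, hz, rfl⟩
    · exact Or.inl (by simpa using hy)
  exact ⟨fun hz => by simpa using h _ hz, h z⟩

theorem conj_mem_seg {K : Set ℂ} {z : ℂ} : (starRingEnd ℂ) z ∈ seg K ↔ z ∈ seg K := by
  have h : ∀ z, z ∈ seg K → (starRingEnd ℂ) z ∈ seg K := by
    rintro _ ⟨t, ht, rfl⟩
    exact ⟨t, ht, by simp⟩
  exact ⟨fun hz => by simpa using h _ hz, h z⟩

theorem Kdoub_mono {K₁ K₂ : Set ℂ} (h : K₁ ⊆ K₂) : Kdoub K₁ ⊆ Kdoub K₂ :=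
  union_subset_union (closure_mono h) (image_mono (closure_mono h))

theorem ofReal_mem_Kdoub {K : Set ℂ} {x : ℝ} : (x : ℂ) ∈ Kdoub K ↔ (x : ℂ) ∈ closure K := by
  refine ⟨?_, Or.inl⟩
  rintro (h | ⟨y, hy, hyx⟩)
  · exact h
  · have := congrArg (starRingEnd ℂ) hyx
    rw [Complex.conj_conj, Complex.conj_ofReal] at this
    rwa [← this]

theorem isCompact_real_closure {K : Set ℂ} (hK : IsBounded K) :
    IsCompact {x : ℝ | (x : ℂ) ∈ closure K} :=
  Complex.isometry_ofReal.isClosedEmbedding.isCompact_preimage hK.isCompact_closure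

theorem ofReal_mem_seg {K : Set ℂ} {x : ℝ} : (x : ℂ) ∈ seg K ↔ aK K ≤ x ∧ x ≤ bK K := by
  refine ⟨?_, fun h => ⟨x, h, rfl⟩⟩
  rintro ⟨t, ht, htx⟩
  rw [← Complex.ofReal_injective htx]
  exact ht

theorem isOpen_extDomain {K : Set ℂ} (hK : IsBounded K) : IsOpen (extDomain K) :=
  (isCompact_Kdoub hK).isClosed.isOpen_compl.inter (isCompact_seg K).isClosed.isOpen_compl

theorem ofReal_mem_offReal {S : Set ℝ} {x : ℝ} : (x : ℂ) ∈ offReal S ↔ x ∉ S := by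
  simp only [offReal, mem_ofPred_eq, ne_eq, Complex.ofReal_inj]
  exact ⟨fun h hx => h x hx rfl, fun h s hs hxs => h (hxs ▸ hs)⟩

theorem mem_offReal_of_im_pos {S : Set ℝ} {z : ℂ} (hz : 0 < z.im) : z ∈ offReal S := by
  rintro s - rfl
  simp at hz

/-- `f` is the inverse of the extended mapping-out function `g` of the hull `K`. -/
structure IsHullInverse (K : Set ℂ) (g : ℂ → ℂ) (S : Set ℝ) (f : ℂ → ℂ) : Prop where
  mem_extDomain : ∀ w ∈ offReal S, f w ∈ extDomain K
  right_inv : ∀ w ∈ offReal S, g (f w) = w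
  left_inv : ∀ z ∈ extDomain K, f (g z) = z
  differentiableAt : ∀ w ∈ offReal S, DifferentiableAt ℂ f w
  hydro : Tendsto (fun w => f w - w) (cobounded ℂ) (𝓝 0)

namespace IsHullMap

variable {K : Set ℂ} {g : ℂ → ℂ} {S : Set ℝ}

theorem notMem_Kdoub (h : IsHullMap K g S) {z : ℂ} (hz : 0 < z.im) (hzK : z ∉ K) :
    z ∉ Kdoub K := by
  rintro (hc | ⟨y, hy, rfl⟩)
  · exact hzK (h.relClosed z hc hz)
  · have : 0 ≤ y.im := closure_minimal (fun w hw => le_of_lt (h.subset_UHP hw))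
      (isClosed_le continuous_const Complex.continuous_im) hy
    simp at hz
    linarith

theorem mem_extDomain (h : IsHullMap K g S) {z : ℂ} (hz : 0 < z.im) (hzK : z ∉ K) :
    z ∈ extDomain K := by
  refine ⟨h.notMem_Kdoub hz hzK, ?_⟩
  rintro ⟨t, -, rfl⟩
  simp at hz

theorem differentiableAt (h : IsHullMap K g S) (hne : K.Nonempty) {z : ℂ} (hz : z ∉ Kdoub K) :
    DifferentiableAt ℂ g z :=
  (h.ext_holo hne).differentiableAt
    ((isCompact_Kdoub h.bounded).isClosed.isOpen_compl.mem_nhds hz)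

theorem extDomain_mem_cobounded (h : IsHullMap K g S) : extDomain K ∈ cobounded ℂ := by
  have : extDomain K = (Kdoub K ∪ seg K)ᶜ := by rw [compl_union]; rfl
  rw [this, ← isBounded_def]
  exact ((isCompact_Kdoub h.bounded).union (isCompact_seg K)).isBounded

theorem exists_inverse (h : IsHullMap K g S) (hne : K.Nonempty) :
    ∃ f, IsHullInverse K g S f := by
  have hb : BijOn g (extDomain K) (offReal S) := h.extBij hne
  have hl : ∀ z ∈ extDomain K, Function.invFunOn g (extDomain K) (g z) = z :=
    fun z hz => hb.injOn.leftInvOn_invFunOn hz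
  refine ⟨Function.invFunOn g (extDomain K), fun w hw => hb.surjOn.mapsTo_invFunOn hw,
    fun w hw => hb.surjOn.rightInvOn_invFunOn hw, hl, fun w hw => ?_, ?_⟩
  · obtain ⟨z, hz, rfl⟩ := hb.surjOn hw
    exact differentiableAt_of_leftInverse (isOpen_extDomain h.bounded)
      ((h.ext_holo hne).mono fun y hy => hy.1) hl hz
  · have hd : ∀ᶠ z in cobounded ℂ, DifferentiableAt ℂ g z := by
      filter_upwards [h.extDomain_mem_cobounded] with z hz using h.differentiableAt hne hz.1
    refine (tendsto_map'_iff.2 ?_).mono_left (cobounded_le_map_of_sub_tendsto_zero hd h.hydro)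
    have := h.hydro.neg
    rw [neg_zero] at this
    refine this.congr' ?_
    filter_upwards [h.extDomain_mem_cobounded] with z hz
    simp [hl z hz]

end IsHullMap

namespace IsHullInverse

variable {K : Set ℂ} {g f : ℂ → ℂ} {S : Set ℝ}

theorem im_pos (hf : IsHullInverse K g S f) (h : IsHullMap K g S) {w : ℂ} (hw : 0 < w.im) :
    0 < (f w).im ∧ f w ∉ K := by
  obtain ⟨z, hz, rfl⟩ := h.bij.surjOn hw
  rw [hf.left_inv z (h.mem_extDomain hz.1 hz.2)]
  exact hz

theorem ofReal_re (hf : IsHullInverse K g S f) (h : IsHullMap K g S) (hne : K.Nonempty) {t : ℝ}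
    (ht : t ∉ S) : ((f t).re : ℂ) = f t := by
  have hD := hf.mem_extDomain t (ofReal_mem_offReal.2 ht)
  have h1 := hf.left_inv ((starRingEnd ℂ) (f t))
    ⟨fun hc => hD.1 (conj_mem_Kdoub.1 hc), fun hc => hD.2 (conj_mem_seg.1 hc)⟩
  rw [h.conj_symm hne _ hD.1, hf.right_inv t (ofReal_mem_offReal.2 ht), Complex.conj_ofReal] at h1
  exact Complex.conj_eq_iff_re.1 h1.symm

theorem comp_hydro {g' : ℂ → ℂ} (hf : IsHullInverse K g S f)
    (hg' : Tendsto (fun z => g' z - z) (cobounded ℂ) (𝓝 0)) :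
    Tendsto (fun w => g' (f w) - w) (cobounded ℂ) (𝓝 0) := by
  have := (hg'.comp (tendsto_cobounded_of_sub_tendsto hf.hydro)).add hf.hydro
  simpa [Function.comp_def] using this

theorem not_subset_singleton (hf : IsHullInverse K g S f) (h : IsHullMap K g S)
    (hne : K.Nonempty) (p : ℝ) : ¬ S ⊆ {p} := by
  intro hS
  have hoff : ∀ w : ℂ, w ≠ p → w ∈ offReal S := by
    rintro w hw s hs rfl
    exact hw (by rw [hS hs])
  obtain ⟨R, hR⟩ : ∃ R, ∀ z : ℂ, R ≤ ‖z‖ → ‖g z - z‖ < 1 := by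
    have h1 : ∀ᶠ z in cobounded ℂ, ‖g z - z‖ < 1 :=
      h.hydro.norm.eventually (gt_mem_nhds (by simp))
    rw [← comap_norm_atTop, eventually_comap, eventually_atTop] at h1
    obtain ⟨R, hR⟩ := h1
    exact ⟨R, fun z hz => hR ‖z‖ hz z rfl⟩
  have hbd : ∀ w : ℂ, w ≠ p → ‖f w‖ ≤ max R (‖w‖ + 1) := by
    intro w hw
    by_contra! hlt
    obtain ⟨h1, h2⟩ := max_lt_iff.1 hlt
    have h3 := hR _ h1.le
    rw [hf.right_inv w (hoff w hw)] at h3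
    have := norm_sub_norm_le (f w) w
    rw [norm_sub_rev] at this
    linarith
  have hU := differentiableOn_update_limUnder_of_bddAbove (f := f)
    (ball_mem_nhds (p : ℂ) one_pos)
    (fun w hw => (hf.differentiableAt w (hoff w hw.2)).differentiableWithinAt) (by
      refine ⟨max R (‖(p : ℂ)‖ + 1 + 1), ?_⟩
      rintro _ ⟨w, hw, rfl⟩
      refine (hbd w hw.2).trans ?_
      have h1 : ‖w - p‖ < 1 := by simpa [dist_eq_norm] using hw.1
      have h2 := norm_sub_norm_le w p
      gcongr
      linarith)
  set F := Function.update f p (limUnder (𝓝[≠] (p : ℂ)) f) with hFdef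
  have hFne : ∀ w : ℂ, w ≠ p → F w = f w := fun w hw => Function.update_of_ne hw _ _
  have hF : Differentiable ℂ F := by
    intro w
    by_cases hw : w = p
    · rw [hw]
      exact hU.differentiableAt (ball_mem_nhds _ one_pos)
    · refine (hf.differentiableAt w (hoff w hw)).congr_of_eventuallyEq ?_
      filter_upwards [isOpen_ne.mem_nhds hw] with y hy using hFne y hy
  have hlim : Tendsto (fun w => F w - w) (cocompact ℂ) (𝓝 0) := by
    rw [← Metric.cobounded_eq_cocompact]
    refine hf.hydro.congr' ?_
    filter_upwards [eventually_ne_cobounded (p : ℂ)] with w hw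
    rw [hFne w hw]
  obtain ⟨z, hz⟩ := hne
  have hzp : z ≠ p := by
    rintro rfl
    have := h.subset_UHP hz
    simp [UHP] at this
  have h1 := (hF.sub differentiable_id).apply_eq_of_tendsto_cocompact z hlim
  simp only [Pi.sub_apply, id_eq, sub_eq_zero] at h1
  rw [hFne z hzp] at h1
  have h2 := (hf.mem_extDomain z (hoff z hzp)).1
  rw [h1] at h2
  exact h2 (Or.inl (subset_closure hz))

theorem nonempty (hf : IsHullInverse K g S f) (h : IsHullMap K g S)
    (hne : K.Nonempty) : S.Nonempty := by
  rw [nonempty_iff_ne_empty]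
  rintro rfl
  exact hf.not_subset_singleton h hne 0 (empty_subset _)

/-- The closure of a nonempty hull meets the real line. -/
theorem real_closure_nonempty (hf : IsHullInverse K g S f) (h : IsHullMap K g S)
    (hne : K.Nonempty) : {x : ℝ | (x : ℂ) ∈ closure K}.Nonempty := by
  by_contra hE
  rw [not_nonempty_iff_eq_empty] at hE
  have hK : ∀ x : ℝ, (x : ℂ) ∉ Kdoub K := fun x hx =>
    (eq_empty_iff_forall_notMem.1 hE x) (ofReal_mem_Kdoub.1 hx)
  have hseg : ∀ x : ℝ, x ≠ 0 → (x : ℂ) ∉ seg K := by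
    intro x hx hxs
    rw [ofReal_mem_seg, aK, bK, hE, Real.sInf_empty, Real.sSup_empty] at hxs
    exact hx (le_antisymm hxs.2 hxs.1)
  refine hf.not_subset_singleton h hne (g (0 : ℝ)).re fun s hs => ?_
  have hcont : Continuous fun t : ℝ => (g t).re := continuous_iff_continuousAt.2 fun t =>
    Complex.continuous_re.continuousAt.comp ((h.differentiableAt hne (hK t)).continuousAt.comp
      Complex.continuous_ofReal.continuousAt)
  have hsub : Tendsto (fun z : ℂ => (g z - z).re) (cobounded ℂ) (𝓝 0) := by
    simpa [Function.comp_def] using (Complex.continuous_re.tendsto 0).comp h.hydro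
  have hbot : Tendsto (fun t : ℝ => (g t).re) atBot atBot := by
    refine (tendsto_id.atBot_add (hsub.comp tendsto_ofReal_atBot_cobounded)).congr fun u => ?_
    simp
  have htop : Tendsto (fun t : ℝ => (g t).re) atTop atTop := by
    have : Tendsto (fun t : ℝ => (t : ℂ)) atTop (cobounded ℂ) := by
      rw [← tendsto_norm_atTop_iff_cobounded]
      simpa using tendsto_abs_atTop_atTop
    refine (tendsto_id.atTop_add (hsub.comp this)).congr fun u => ?_
    simp
  obtain ⟨x, hx⟩ := hcont.surjective htop hbot s
  simp only at hx
  by_cases hx0 : x = 0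
  · rw [← hx, hx0]; rfl
  · refine absurd ?_ ((h.extBij hne).mapsTo (x := (x : ℂ)) ⟨hK x, hseg x hx0⟩ s hs)
    exact Complex.ext (by simpa using hx) (by simpa using h.real_vals hne x (hK x))

end IsHullInverse

theorem seg_subset_seg {K₁ K₂ : Set ℂ} (hsub : K₁ ⊆ K₂) (hK₂ : IsBounded K₂)
    (hne : {x : ℝ | (x : ℂ) ∈ closure K₁}.Nonempty) : seg K₁ ⊆ seg K₂ := by
  have hss : {x : ℝ | (x : ℂ) ∈ closure K₁} ⊆ {x : ℝ | (x : ℂ) ∈ closure K₂} :=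
    fun x hx => closure_mono hsub hx
  exact image_mono (Icc_subset_Icc
    (csInf_le_csInf (isCompact_real_closure hK₂).bddBelow hne hss)
    (csSup_le_csSup (isCompact_real_closure hK₂).bddAbove hne hss))

section Comparison

variable {K₁ K₂ : Set ℂ} {g₁ g₂ : ℂ → ℂ} {S₁ S₂ : Set ℝ}

/-- Monotonicity of `c_K`. -/
theorem sInf_le_sInf_of_subset (h₁ : IsHullMap K₁ g₁ S₁) (h₂ : IsHullMap K₂ g₂ S₂)
    (hne₁ : K₁.Nonempty) (hsub : K₁ ⊆ K₂) : sInf S₂ ≤ sInf S₁ := by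
  have hne₂ := hne₁.mono hsub
  obtain ⟨f₁, hf₁⟩ := h₁.exists_inverse hne₁
  obtain ⟨f₂, hf₂⟩ := h₂.exists_inverse hne₂
  have hseg := seg_subset_seg hsub h₂.bounded (hf₁.real_closure_nonempty h₁ hne₁)
  have hF : Tendsto (fun w => g₁ (f₂ w) - w) (cobounded ℂ) (𝓝 0) := hf₂.comp_hydro h₁.hydro
  have hS : ∀ t : ℝ, t < sInf S₂ → t ∉ S₂ := fun t ht hts =>
    ht.not_ge (csInf_le h₂.compactS.bddBelow hts)
  have hD : ∀ w ∈ offReal S₂, f₂ w ∈ extDomain K₁ := fun w hw =>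
    have := hf₂.mem_extDomain w hw
    ⟨fun hc => this.1 (Kdoub_mono hsub hc), fun hc => this.2 (hseg hc)⟩
  have hd : ∀ w ∈ offReal S₂, DifferentiableAt ℂ (fun w => g₁ (f₂ w)) w := fun w hw =>
    (h₁.differentiableAt hne₁ (hD w hw).1).comp w (hf₂.differentiableAt w hw)
  have him : ∀ t : ℝ, t < sInf S₂ → (g₁ (f₂ t)).im = 0 := by
    intro t ht
    have h1 := (hD t (ofReal_mem_offReal.2 (hS t ht))).1
    rw [← hf₂.ofReal_re h₂ hne₂ (hS t ht)] at h1 ⊢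
    exact h₁.real_vals hne₁ _ h1
  refine le_csInf (hf₁.nonempty h₁ hne₁) fun s hs => le_of_forall_lt fun t ht => ?_
  obtain ⟨t', htt', ht'⟩ := exists_between ht
  refine htt'.trans_le ?_
  have hlow := halfDisc_map_le_of_lt (F := fun w => g₁ (f₂ w)) (x₀ := sInf S₂) (r := 0)
    (c := sInf S₂) (fun w hw _ => hd w (mem_offReal_of_im_pos hw)) (fun w hw _ => by
      obtain ⟨h1, h2⟩ := hf₂.im_pos h₂ hw
      exact h₁.bij.mapsTo ⟨h1, fun hc => h2 (hsub hc)⟩) le_rfl hF (by simp)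
    (fun u hu => hd u (ofReal_mem_offReal.2 (hS u hu))) him ht'
  have hup := le_of_forall_notMem (F := fun w => g₁ (f₂ w)) (c := sInf S₂) (S := S₁)
    (fun u hu => (hd u (ofReal_mem_offReal.2 (hS u hu))).continuousAt) hF (fun u hu hus => by
      refine (h₁.extBij hne₁).mapsTo (hD u (ofReal_mem_offReal.2 (hS u hu))) _ hus ?_
      exact Complex.ext rfl (by simpa using him u hu)) ht' hs
  simp at hlow
  exact hlow.trans hup

/-- If the quotient hull lies in a disc of radius `r` centred at a real point to the right of
`c_{K₁}`, then passing from `K₁` to `K₂` moves `c` to the left by at most `2 r`. -/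
theorem sInf_sub_le_sInf (h₁ : IsHullMap K₁ g₁ S₁) (h₂ : IsHullMap K₂ g₂ S₂)
    (hne₁ : K₁.Nonempty) (hsub : K₁ ⊆ K₂) {x₀ r : ℝ} (hr : 0 ≤ r) (hx₀ : sInf S₁ ≤ x₀)
    (hQ : g₁ '' (K₂ \ K₁) ⊆ closedBall (x₀ : ℂ) r) : sInf S₁ - 2 * r ≤ sInf S₂ := by
  have hne₂ := hne₁.mono hsub
  obtain ⟨f₁, hf₁⟩ := h₁.exists_inverse hne₁
  obtain ⟨f₂, hf₂⟩ := h₂.exists_inverse hne₂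
  set c := sInf S₁ - r with hc
  have hF : Tendsto (fun w => g₂ (f₁ w) - w) (cobounded ℂ) (𝓝 0) := hf₁.comp_hydro h₂.hydro
  have hS : ∀ t : ℝ, t < c → t ∉ S₁ := fun t ht hts =>
    (ht.trans_le (by linarith)).not_ge (csInf_le h₁.compactS.bddBelow hts)
  have hoff : ∀ t : ℝ, t < c → (t : ℂ) ∈ offReal S₁ := fun t ht => ofReal_mem_offReal.2 (hS t ht)
  have hre : ∀ t : ℝ, t < c → ((f₁ t).re : ℂ) = f₁ t := fun t ht => hf₁.ofReal_re h₁ hne₁ (hS t ht)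
  have hK₂ : ∀ w : ℂ, 0 < w.im → r < ‖w - x₀‖ → f₁ w ∉ K₂ := by
    intro w hw hwr hmem
    have := hQ ⟨f₁ w, ⟨hmem, (hf₁.im_pos h₁ hw).2⟩, rfl⟩
    rw [hf₁.right_inv w (mem_offReal_of_im_pos hw), mem_closedBall, dist_eq_norm] at this
    linarith
  have hcl : ∀ t : ℝ, t < c → f₁ t ∉ closure K₂ := by
    intro t ht hmem
    have hD := hf₁.mem_extDomain t (hoff t ht)
    rw [← union_sdiff_cancel hsub, closure_union] at hmem
    refine hmem.elim (fun h => hD.1 (Or.inl h)) fun h => ?_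
    have h1 : g₁ (f₁ t) ∈ closure (g₁ '' (K₂ \ K₁)) :=
      (h₁.differentiableAt hne₁ hD.1).continuousAt.continuousWithinAt.mem_closure_image h
    rw [hf₁.right_inv t (hoff t ht)] at h1
    have h2 := closure_minimal hQ isClosed_closedBall h1
    rw [mem_closedBall, dist_eq_norm, ← Complex.ofReal_sub, Complex.norm_real,
      Real.norm_eq_abs, abs_of_neg (by linarith)] at h2
    linarith
  have hdoub : ∀ t : ℝ, t < c → f₁ t ∉ Kdoub K₂ := by
    intro t ht
    have := hcl t ht
    rw [← hre t ht] at this ⊢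
    exact fun hmem => this (ofReal_mem_Kdoub.1 hmem)
  have hleft : ∀ t : ℝ, t < c → f₁ t ∉ seg K₂ := by
    intro t ht hmem
    have hne := hf₂.real_closure_nonempty h₂ hne₂
    rw [← hre t ht, ofReal_mem_seg] at hmem
    have hmin : ((aK K₂ : ℝ) : ℂ) ∈ closure K₂ := (isCompact_real_closure h₂.bounded).sInf_mem hne
    have hle := le_of_forall_notMem (F := f₁) (c := c) (S := {x : ℝ | (x : ℂ) ∈ closure K₂})
      (fun u hu => (hf₁.differentiableAt u (hoff u hu)).continuousAt) hf₁.hydro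
      (fun u hu hmem => hcl u hu (by rw [← hre u hu]; exact hmem)) ht hmin
    have heq : (f₁ t).re = aK K₂ := le_antisymm hle hmem.1
    exact hcl t ht (by rw [← hre t ht, heq]; exact hmin)
  have hdr : ∀ t : ℝ, t < c → DifferentiableAt ℂ (fun w => g₂ (f₁ w)) t := fun t ht =>
    (h₂.differentiableAt hne₂ (hdoub t ht)).comp (t : ℂ) (hf₁.differentiableAt t (hoff t ht))
  have him : ∀ t : ℝ, t < c → (g₂ (f₁ t)).im = 0 := by
    intro t ht
    have h1 := hdoub t ht
    rw [← hre t ht] at h1 ⊢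
    exact h₂.real_vals hne₂ _ h1
  refine le_csInf (hf₂.nonempty h₂ hne₂) fun s hs => le_of_forall_lt fun t ht => ?_
  obtain ⟨t', htt', ht'⟩ := exists_between ht
  refine htt'.trans_le ?_
  have htc : t' + r < c := by linarith
  have hlow := halfDisc_map_le_of_lt (F := fun w => g₂ (f₁ w)) (x₀ := x₀) (r := r)
    (c := c) (fun w hw hwr => (h₂.differentiableAt hne₂ (h₂.notMem_Kdoub
      (hf₁.im_pos h₁ hw).1 (hK₂ w hw hwr))).comp w
        (hf₁.differentiableAt w (mem_offReal_of_im_pos hw)))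
    (fun w hw hwr => h₂.bij.mapsTo ⟨(hf₁.im_pos h₁ hw).1, hK₂ w hw hwr⟩) hr hF (by linarith)
    hdr him htc
  have hup := le_of_forall_notMem (F := fun w => g₂ (f₁ w)) (c := c) (S := S₂)
    (fun u hu => (hdr u hu).continuousAt) hF (fun u hu hus => by
      refine (h₂.extBij hne₂).mapsTo ⟨hdoub u hu, hleft u hu⟩ _ hus ?_
      exact Complex.ext rfl (by simpa using him u hu)) htc hs
  have hfrac : -r ≤ r ^ 2 / (t' + r - x₀) := by
    rw [le_div_iff_of_neg (by linarith)]
    nlinarith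
  linarith

theorem isBounded_quotient (h₁ : IsHullMap K₁ g₁ S₁) (h₂ : IsHullMap K₂ g₂ S₂)
    (hne₁ : K₁.Nonempty) : IsBounded (g₁ '' (K₂ \ K₁)) := by
  obtain ⟨f₁, hf₁⟩ := h₁.exists_inverse hne₁
  have h := tendsto_cobounded_of_sub_tendsto hf₁.hydro (isBounded_def.1 h₂.bounded)
  rw [isBounded_def]
  filter_upwards [h] with w hw
  rintro ⟨z, hz, rfl⟩
  refine hw ?_
  rw [hf₁.left_inv z (h₁.mem_extDomain (h₂.subset_UHP hz.1) hz.2)]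
  exact hz.1

theorem abs_sInf_sub_sInf_le (h₁ : IsHullMap K₁ g₁ S₁) (h₂ : IsHullMap K₂ g₂ S₂)
    (hne₁ : K₁.Nonempty) (hsub : K₁ ⊆ K₂)
    (hint : (closure (g₁ '' (K₂ \ K₁)) ∩
      ((fun t : ℝ => (t : ℂ)) '' Set.Icc (sInf S₁) (sSup S₁))).Nonempty) :
    |sInf S₁ - sInf S₂| ≤ 4 * Metric.diam (g₁ '' (K₂ \ K₁)) := by
  obtain ⟨_, hx, x₀, hx₀, rfl⟩ := hint
  have hb := (isBounded_quotient h₁ h₂ hne₁).closure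
  have hQ : g₁ '' (K₂ \ K₁) ⊆ closedBall (x₀ : ℂ) (diam (g₁ '' (K₂ \ K₁))) := by
    intro w hw
    rw [mem_closedBall, ← diam_closure]
    exact dist_le_diam_of_mem hb (subset_closure hw) hx
  have hr : 0 ≤ diam (g₁ '' (K₂ \ K₁)) := diam_nonneg
  have hlow := sInf_sub_le_sInf h₁ h₂ hne₁ hsub hr hx₀.1 hQ
  have hup := sInf_le_sInf_of_subset h₁ h₂ hne₁ hsub
  rw [abs_of_nonneg (by linarith)]
  linarith

end Comparison

/-- Reflection in the imaginary axis. -/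
def imReflect : ℂ ≃ᵢ ℂ :=
  (Complex.conjLIE.trans (LinearIsometryEquiv.neg ℝ)).toIsometryEquiv

theorem imReflect_apply (z : ℂ) : imReflect z = -(starRingEnd ℂ) z := rfl

theorem imReflect_imReflect (z : ℂ) : imReflect (imReflect z) = z := by
  simp [imReflect_apply]

theorem imReflect_im (z : ℂ) : (imReflect z).im = z.im := by
  simp [imReflect_apply]

theorem imReflect_ofReal (x : ℝ) : imReflect (x : ℂ) = ((-x : ℝ) : ℂ) := by
  simp [imReflect_apply]

theorem imReflect_conj (z : ℂ) :
    imReflect ((starRingEnd ℂ) z) = (starRingEnd ℂ) (imReflect z) := by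
  simp [imReflect_apply]

theorem imReflect_sub (z w : ℂ) : imReflect (z - w) = imReflect z - imReflect w := by
  simp only [imReflect_apply, map_sub]; ring

theorem closure_preimage_imReflect (K : Set ℂ) :
    closure (imReflect ⁻¹' K) = imReflect ⁻¹' closure K :=
  (imReflect.toHomeomorph.preimage_closure K).symm

theorem Kdoub_preimage_imReflect (K : Set ℂ) : Kdoub (imReflect ⁻¹' K) = imReflect ⁻¹' Kdoub K := by
  ext z
  simp only [Kdoub, closure_preimage_imReflect, mem_union, mem_preimage, mem_image]
  refine or_congr_right ⟨?_, ?_⟩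
  · rintro ⟨y, hy, rfl⟩
    exact ⟨imReflect y, hy, (imReflect_conj y).symm⟩
  · rintro ⟨y, hy, hyz⟩
    refine ⟨imReflect y, by rwa [imReflect_imReflect], ?_⟩
    rw [← imReflect_conj, hyz, imReflect_imReflect]

theorem real_closure_preimage_imReflect (K : Set ℂ) :
    {x : ℝ | (x : ℂ) ∈ closure (imReflect ⁻¹' K)} = -{x : ℝ | (x : ℂ) ∈ closure K} := by
  ext x
  rw [closure_preimage_imReflect, mem_ofPred_eq, mem_preimage, imReflect_ofReal]
  rfl

theorem seg_preimage_imReflect (K : Set ℂ) : seg (imReflect ⁻¹' K) = imReflect ⁻¹' seg K := by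
  have ha : aK (imReflect ⁻¹' K) = -bK K := by
    rw [aK, real_closure_preimage_imReflect, Real.sInf_neg]; rfl
  have hb : bK (imReflect ⁻¹' K) = -aK K := by
    rw [bK, real_closure_preimage_imReflect, Real.sSup_neg]; rfl
  ext z
  simp only [seg, ha, hb, mem_preimage, mem_image, mem_Icc]
  constructor
  · rintro ⟨t, ht, rfl⟩
    exact ⟨-t, ⟨by linarith, by linarith⟩, (imReflect_ofReal t).symm⟩
  · rintro ⟨t, ht, htz⟩
    refine ⟨-t, ⟨by linarith, by linarith⟩, ?_⟩
    rw [← imReflect_ofReal, htz, imReflect_imReflect]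

theorem bijOn_imReflect {g : ℂ → ℂ} {A B : Set ℂ} (h : BijOn g A B) :
    BijOn (fun z => imReflect (g (imReflect z))) (imReflect ⁻¹' A) (imReflect ⁻¹' B) := by
  refine ⟨fun z hz => ?_, fun z hz w hw hzw => ?_, fun w hw => ?_⟩
  · rw [mem_preimage, imReflect_imReflect]
    exact h.mapsTo hz
  · exact imReflect.injective (h.injOn hz hw (imReflect.injective hzw))
  · obtain ⟨z, hz, hzw⟩ := h.surjOn hw
    refine ⟨imReflect z, by rwa [mem_preimage, imReflect_imReflect], ?_⟩
    simp only [imReflect_imReflect, hzw]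

theorem differentiableOn_imReflect {g : ℂ → ℂ} {A : Set ℂ} (hA : IsOpen A)
    (h : DifferentiableOn ℂ g A) :
    DifferentiableOn ℂ (fun z => imReflect (g (imReflect z))) (imReflect ⁻¹' A) := by
  intro z hz
  have h1 : DifferentiableAt ℂ g (-(starRingEnd ℂ) z) := h.differentiableAt (hA.mem_nhds hz)
  have h2 : DifferentiableAt ℂ (fun u => -g (-u)) ((starRingEnd ℂ) z) :=
    (h1.comp ((starRingEnd ℂ) z) differentiableAt_id.neg).neg
  have h3 := differentiableAt_conj_conj_iff.2 h2
  simpa [Function.comp_def, imReflect_apply] using h3.differentiableWithinAt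

theorem tendsto_imReflect_cobounded : Tendsto imReflect (cobounded ℂ) (cobounded ℂ) := by
  rw [← tendsto_norm_atTop_iff_cobounded]
  refine tendsto_norm_cobounded_atTop.congr fun z => ?_
  simp [imReflect_apply]

theorem IsHullMap.reflect {K : Set ℂ} {g : ℂ → ℂ} {S : Set ℝ} (h : IsHullMap K g S) :
    IsHullMap (imReflect ⁻¹' K) (fun z => imReflect (g (imReflect z))) (-S) := by
  have hne : (imReflect ⁻¹' K).Nonempty → K.Nonempty := fun ⟨z, hz⟩ => ⟨_, hz⟩
  have hU : imReflect ⁻¹' UHP = UHP := by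
    ext z; simp [UHP, imReflect_im]
  have hdom : UHP \ (imReflect ⁻¹' K) = imReflect ⁻¹' (UHP \ K) := by
    rw [preimage_sdiff, hU]
  have hopen : IsOpen (UHP \ K) := by
    have : UHP \ K = UHP \ closure K := by
      ext z
      exact and_congr_right fun hz => not_congr ⟨fun h => subset_closure h,
        fun hc => h.relClosed z hc hz⟩
    rw [this]
    exact (isOpen_lt continuous_const Complex.continuous_im).sdiff isClosed_closure
  refine
    { subset_UHP := fun z hz => hU ▸ h.subset_UHP hz
      bounded := imReflect.isometry.antilipschitz.isBounded_preimage h.bounded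
      relClosed := fun z hz hzi => h.relClosed _
        (by rwa [closure_preimage_imReflect] at hz) (by rwa [imReflect_im])
      holo := hdom ▸ differentiableOn_imReflect hopen h.holo
      bij := by
        have := bijOn_imReflect h.bij
        rwa [hU, ← hdom] at this
      hydro := ?_
      compactS := h.compactS.neg
      ext_holo := fun hK => by
        rw [Kdoub_preimage_imReflect]
        exact differentiableOn_imReflect (isCompact_Kdoub h.bounded).isClosed.isOpen_compl
          (h.ext_holo (hne hK))
      real_vals := fun hK x hx => ?_
      conj_symm := fun hK z hz => ?_
      extBij := fun hK => ?_ }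
  · have := (imReflect.continuous.tendsto 0).comp (h.hydro.comp tendsto_imReflect_cobounded)
    rw [show imReflect 0 = 0 by simp [imReflect_apply]] at this
    refine this.congr fun z => ?_
    simp only [Function.comp_apply, imReflect_sub, imReflect_imReflect]
  · rw [Kdoub_preimage_imReflect, mem_preimage, imReflect_ofReal] at hx
    rw [imReflect_im, imReflect_ofReal]
    exact h.real_vals (hne hK) _ hx
  · rw [Kdoub_preimage_imReflect] at hz
    rw [imReflect_conj, h.conj_symm (hne hK) _ hz, imReflect_conj]
  · have := bijOn_imReflect (h.extBij (hne hK))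
    rw [Kdoub_preimage_imReflect, seg_preimage_imReflect]
    have hcod : {z : ℂ | ∀ s ∈ -S, z ≠ (s : ℂ)} =
        imReflect ⁻¹' {z : ℂ | ∀ s ∈ S, z ≠ (s : ℂ)} := by
      ext z
      change (∀ s ∈ -S, z ≠ (s : ℂ)) ↔ ∀ s ∈ S, imReflect z ≠ (s : ℂ)
      refine ⟨fun hz s hs hzs => hz (-s) (by simpa using hs) ?_, fun hz s hs hzs => hz (-s) hs ?_⟩
      · rw [← imReflect_ofReal, ← hzs, imReflect_imReflect]
      · rw [hzs, imReflect_ofReal]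
    rw [hcod]
    exact this

/-- **Stability of `c_K`, `d_K` under growth of hulls.** Let `K₁ ⊆ K₂` be nonempty `ℍ`-hulls
such that the closure of the quotient hull `K₂/K₁ = g_{K₁}(K₂ \ K₁)` meets `[c_{K₁}, d_{K₁}]`.
Then `|c_{K₁} - c_{K₂}| ≤ 4 diam(K₂/K₁)` and `|d_{K₁} - d_{K₂}| ≤ 4 diam(K₂/K₁)`. -/
theorem stmt_4 (K₁ K₂ : Set ℂ) (g₁ g₂ : ℂ → ℂ) (S₁ S₂ : Set ℝ)
    (h₁ : IsHullMap K₁ g₁ S₁) (h₂ : IsHullMap K₂ g₂ S₂)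
    (hne₁ : K₁.Nonempty) (hne₂ : K₂.Nonempty) (hsub : K₁ ⊆ K₂)
    (hint : (closure (g₁ '' (K₂ \ K₁)) ∩
      ((fun t : ℝ => (t : ℂ)) '' Set.Icc (sInf S₁) (sSup S₁))).Nonempty) :
    |sInf S₁ - sInf S₂| ≤ 4 * Metric.diam (g₁ '' (K₂ \ K₁))
    ∧ |sSup S₁ - sSup S₂| ≤ 4 * Metric.diam (g₁ '' (K₂ \ K₁)) := by
  refine ⟨abs_sInf_sub_sInf_le h₁ h₂ hne₁ hsub hint, ?_⟩
  have himage : (fun z => imReflect (g₁ (imReflect z))) '' (imReflect ⁻¹' K₂ \ imReflect ⁻¹' K₁) =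
      imReflect '' (g₁ '' (K₂ \ K₁)) := by
    rw [← preimage_sdiff, image_image]
    ext w
    constructor
    · rintro ⟨z, hz, rfl⟩
      exact ⟨_, hz, rfl⟩
    · rintro ⟨z, hz, rfl⟩
      exact ⟨imReflect z, by rwa [mem_preimage, imReflect_imReflect],
        by simp only [imReflect_imReflect]⟩
  have hmain := abs_sInf_sub_sInf_le h₁.reflect h₂.reflect
    (hne₁.preimage imReflect.surjective) (preimage_mono hsub) ?_
  · rw [himage, imReflect.isometry.diam_image, Real.sInf_neg, Real.sInf_neg, neg_sub_neg,
      abs_sub_comm] at hmain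
    exact hmain
  · obtain ⟨_, hx, x, hxS, rfl⟩ := hint
    rw [himage, Real.sInf_neg, Real.sSup_neg]
    refine ⟨imReflect x, ?_, -x, ⟨by linarith [hxS.2], by linarith [hxS.1]⟩,
      (imReflect_ofReal x).symm⟩
    exact image_closure_subset_closure_image imReflect.continuous ⟨_, hx, rfl⟩
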